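/- Let A_{-1}, A_0, A_1, G be as in the context, with G𝟙 = 𝟙, and let σ < 1 be a real number such that (A_{-1} − A_1)𝟙 ≥ (1 − σ)𝟙 entrywise. Suppose X ∈ B(ℓ∞) is positive with X𝟙 = 𝟙 (row-stochastic). Then: (i) A_{-1} + A_0X + A_1X² is positive and maps 𝟙 to 𝟙; (ii) I − A_0 is invertible in B(ℓ∞) with positive inverse, and (I − A_0)^{-1}(A_{-1} + A_1X²) is positive and maps 𝟙 to 𝟙; (iii) I − A_0 − A_1X is invertible in B(ℓ∞) with positive inverse, and (I − A_0 − A_1X)^{-1} A_{-1} is positive and maps 𝟙 to 𝟙. -/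

import Mathlib

open BoundedContinuousFunction Filter

noncomputable section

/-- ℓ∞: the Banach space of bounded real sequences with the sup norm. -/
abbrev Linf : Type := BoundedContinuousFunction ℕ ℝ

/-- A sequence is nonnegative if all its entries are nonnegative. -/
def vnonneg (x : Linf) : Prop := ∀ i, 0 ≤ x i

/-- An operator in B(ℓ∞) is positive if it maps nonnegative sequences to
nonnegative sequences. -/
def OpPos (A : Linf →L[ℝ] Linf) : Prop := ∀ x : Linf, vnonneg x → vnonneg (A x)

/-- The constant sequence with all entries equal to one. -/
def ones : Linf := BoundedContinuousFunction.const ℕ (1 : ℝ)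

theorem OpPos.add {A B : Linf →L[ℝ] Linf} (hA : OpPos A) (hB : OpPos B) : OpPos (A + B) :=
  fun x hx i => add_nonneg (hA x hx i) (hB x hx i)

theorem OpPos.mul {A B : Linf →L[ℝ] Linf} (hA : OpPos A) (hB : OpPos B) : OpPos (A * B) :=
  fun x hx => hA _ (hB x hx)

theorem OpPos.pow {A : Linf →L[ℝ] Linf} (hA : OpPos A) (n : ℕ) : OpPos (A ^ n) := by
  induction n with
  | zero => exact fun x hx => by simpa using hx
  | succ n ih => rw [pow_succ]; exact ih.mul hA

theorem vnonneg_ones : vnonneg ones := fun _ => zero_le_one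

/-- The norm of a positive operator is bounded by any bound on the image of `ones`. -/
theorem OpPos.opNorm_le {A : Linf →L[ℝ] Linf} (hA : OpPos A) {c : ℝ}
    (hc : ∀ i, A ones i ≤ c) : ‖A‖ ≤ c := by
  have hc0 : 0 ≤ c := (hA _ vnonneg_ones 0).trans (hc 0)
  refine A.opNorm_le_bound hc0 fun x => ?_
  refine (norm_le (mul_nonneg hc0 (norm_nonneg x))).2 fun i => ?_
  have hx : ∀ j, -‖x‖ ≤ x j ∧ x j ≤ ‖x‖ := fun j => abs_le.1 (x.norm_coe_le_norm j)
  have h₁ := hA (‖x‖ • ones - x) (fun j => by simpa [ones] using (hx j).2) i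
  have h₂ := hA (‖x‖ • ones + x) (fun j => by
    have := (hx j).1
    simp only [ones, coe_add, coe_smul, Pi.add_apply, const_apply, smul_eq_mul, mul_one]
    linarith) i
  have h₃ := mul_le_mul_of_nonneg_left (hc i) (norm_nonneg x)
  simp only [map_add, map_sub, map_smul, coe_add, coe_sub, coe_smul, Pi.add_apply, Pi.sub_apply,
    smul_eq_mul] at h₁ h₂
  rw [Real.norm_eq_abs, abs_le]
  constructor <;> linarith

/-- The Neumann series of a strict contraction `T` converges pointwise to an inverse of `1 - T`. -/
theorem exists_neumann_inverse {E : Type*} [NormedAddCommGroup E] [NormedSpace ℝ E]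
    [CompleteSpace E] (T : E →L[ℝ] E) (h : ‖T‖ < 1) :
    ∃ B : E →L[ℝ] E, (1 - T) * B = 1 ∧ B * (1 - T) = 1 ∧
      ∀ x, HasSum (fun n : ℕ => (T ^ n) x) (B x) :=
  ⟨∑' n : ℕ, T ^ n, mul_neg_geom_series T h, geom_series_mul_neg T h, fun x =>
    (summable_geometric_of_norm_lt_one h).hasSum.mapL (ContinuousLinearMap.apply ℝ E x)⟩

/-- If `T` is a positive strict contraction, then `1 - T` has a positive inverse. -/
theorem OpPos.exists_inverse_one_sub {T : Linf →L[ℝ] Linf} (hT : OpPos T) (h : ‖T‖ < 1) :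
    ∃ B : Linf →L[ℝ] Linf, (1 - T) * B = 1 ∧ B * (1 - T) = 1 ∧ OpPos B := by
  obtain ⟨B, hB₁, hB₂, hB⟩ := exists_neumann_inverse T h
  refine ⟨B, hB₁, hB₂, fun x hx i => ?_⟩
  exact ((hB x).mapL (evalCLM ℝ i)).nonneg fun n => hT.pow n x hx i

/-- The three fixed point maps preserve positivity and row-stochasticity. -/
theorem stmt3
    (Am1 A0 A1 G : Linf →L[ℝ] Linf)
    (hAm1 : OpPos Am1) (hA0 : OpPos A0) (hA1 : OpPos A1) (hG : OpPos G)
    (hstoch : (Am1 + A0 + A1) ones = ones)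
    (heq : A1 * G ^ 2 + A0 * G + Am1 = G)
    (hG1 : G ones = ones)
    (σ : ℝ) (hσ : σ < 1)
    (hgap : ∀ i, 1 - σ ≤ ((Am1 - A1) ones) i)
    (X : Linf →L[ℝ] Linf) (hX : OpPos X) (hX1 : X ones = ones) :
    (OpPos (Am1 + A0 * X + A1 * X ^ 2) ∧ (Am1 + A0 * X + A1 * X ^ 2) ones = ones) ∧
    (∃ B : Linf →L[ℝ] Linf, (1 - A0) * B = 1 ∧ B * (1 - A0) = 1 ∧ OpPos B ∧
      OpPos (B * (Am1 + A1 * X ^ 2)) ∧ (B * (Am1 + A1 * X ^ 2)) ones = ones) ∧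
    (∃ C : Linf →L[ℝ] Linf, (1 - A0 - A1 * X) * C = 1 ∧ C * (1 - A0 - A1 * X) = 1 ∧
      OpPos C ∧ OpPos (C * Am1) ∧ (C * Am1) ones = ones) := by
  have hX2 : (X ^ 2) ones = ones := by
    rw [pow_two, mul_apply_eq_comp, hX1, hX1]
  have hst : Am1 ones + A0 ones + A1 ones = ones := hstoch
  have hbound : ∀ i, A0 ones i + A1 ones i ≤ σ := fun i => by
    have h₁ : Am1 ones i + A0 ones i + A1 ones i = 1 := DFunLike.congr_fun hst i
    have h₂ : 1 - σ ≤ Am1 ones i - A1 ones i := hgap i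
    have h₃ := hA1 _ vnonneg_ones i
    linarith
  have hA0norm : ‖A0‖ < 1 := (hA0.opNorm_le fun i => by
    have h₁ := hbound i
    have h₂ := hA1 _ vnonneg_ones i
    linarith).trans_lt hσ
  have hTpos : OpPos (A0 + A1 * X) := hA0.add (hA1.mul hX)
  have hTnorm : ‖A0 + A1 * X‖ < 1 := (hTpos.opNorm_le fun i => by
    simpa [hX1] using hbound i).trans_lt hσ
  have hAX2 := hA1.mul (hX.pow 2)
  obtain ⟨B, hB₁, hB₂, hB⟩ := hA0.exists_inverse_one_sub hA0norm
  obtain ⟨C, hC₁, hC₂, hC⟩ := hTpos.exists_inverse_one_sub hTnorm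
  rw [← sub_sub 1 A0 (A1 * X)] at hC₁ hC₂
  refine ⟨⟨(hAm1.add (hA0.mul hX)).add hAX2, ?_⟩,
    ⟨B, hB₁, hB₂, hB, hB.mul (hAm1.add hAX2), ?_⟩, ⟨C, hC₁, hC₂, hC, hC.mul hAm1, ?_⟩⟩
  · simpa [hX1, hX2] using hst
  · have h : (Am1 + A1 * X ^ 2) ones = (1 - A0) ones := by
      simp only [_root_.add_apply, _root_.sub_apply,
        mul_apply_eq_comp, one_apply_eq_self, hX2]
      rw [eq_sub_iff_add_eq, add_right_comm, hst]
    rw [mul_apply_eq_comp, h, ← mul_apply_eq_comp, hB₂,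
      one_apply_eq_self]
  · have h : Am1 ones = (1 - A0 - A1 * X) ones := by
      simp only [_root_.sub_apply, mul_apply_eq_comp,
        one_apply_eq_self, hX1]
      rw [sub_sub, eq_sub_iff_add_eq, ← add_assoc, hst]
    rw [mul_apply_eq_comp, h, ← mul_apply_eq_comp, hC₂,
      one_apply_eq_self]
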